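/- arXiv:2405.01854 — 2 statements merged into one kernel-verified Lean document; each statement's English description precedes it below -/
import Mathlib

section
/- For every π in the image s_{123,132}^{⌊(n−1)/2⌋}(Sₙ), every small entry of π lies in the valley-region of π; that is, if πᵢ ≤ ⌊(n−1)/2⌋ then i ≥ 𝔅(π). -/
open scoped Classical

/-- `π` is a permutation of `{1,…,n}` presented as a list. -/
def IsPermOf (n : ℕ) (π : List ℕ) : Prop :=
  π.Perm ((List.range n).map (· + 1))

/-- 1-indexed entry of a list. -/
def ent (π : List ℕ) (i : ℕ) : ℕ := π.getD (i - 1) 0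

/-- `a` and `b` are order-isomorphic (same length, same relative order). -/
def isoBool (a b : List ℕ) : Bool :=
  (a.length == b.length) &&
    (List.range a.length).all fun i =>
      (List.range a.length).all fun j =>
        !(decide (i < j)) ||
          (decide (a.getD i 0 < a.getD j 0) == decide (b.getD i 0 < b.getD j 0))

/-- `l` contains a subsequence order-isomorphic to the pattern `p`. -/
def containsPat (l p : List ℕ) : Bool :=
  l.sublists.any fun t => isoBool t p

/-- One full run of the right-greedy pattern-avoiding stack machine.
`T` is the list of forbidden patterns; the stack is read top-to-bottom
(head = top).  Push is preferred whenever the resulting stack avoids all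
patterns in `T`; otherwise the top of the stack is popped to the output.
At the end the stack is emptied onto the output. -/
def sortRun (T : List (List ℕ)) : List ℕ → List ℕ → List ℕ → List ℕ
  | [], stack, out => out ++ stack
  | x :: rest, stack, out =>
    if T.all (fun p => !containsPat (x :: stack) p) then
      sortRun T rest (x :: stack) out
    else
      match stack with
      | [] => sortRun T rest [x] out
      | y :: st => sortRun T (x :: rest) st (out ++ [y])
termination_by inp stack _ => 2 * inp.length + stack.length
decreasing_by all_goals (simp only [List.length_cons]; omega)

/-- The generalized stack-sorting map `s_T`. -/
def sortT (T : List (List ℕ)) (π : List ℕ) : List ℕ := sortRun T π [] []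

/-- The stack-sorting map `s_{123,132}`. -/
def s132 (π : List ℕ) : List ℕ := sortT [[1, 2, 3], [1, 3, 2]] π

/-- `π_i` is a left-to-right minimum of `π` (1-indexed). -/
def IsLtrMin (π : List ℕ) (i : ℕ) : Prop :=
  1 ≤ i ∧ i ≤ π.length ∧ ∀ m, 1 ≤ m → m ≤ i → ent π i ≤ ent π m

/-- `π_i` is a valley of `π`. -/
def IsValley (π : List ℕ) (i : ℕ) : Prop :=
  IsLtrMin π i ∧ (i + 1 ≤ π.length → ¬ IsLtrMin π (i + 1)) ∧
    (i + 2 ≤ π.length → IsLtrMin π (i + 2))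

/-- Positions `i, i+1, …, i+j` of `π` form a valley-block: `π_{i+j}` is a
valley and `π_i > ⋯ > π_{i+j}` are the `j+1` smallest entries among
`π_1,…,π_{i+j}`. -/
def IsValleyBlock (π : List ℕ) (i j : ℕ) : Prop :=
  1 ≤ i ∧ i + j ≤ π.length ∧ IsValley π (i + j) ∧
    (∀ k, i ≤ k → k < i + j → ent π (k + 1) < ent π k) ∧
    (∀ m, 1 ≤ m → m < i → ent π i < ent π m)

/-- Auxiliary (fuelled) predicate: the positions `i, i+1, …, π.length` of `π`
decompose as an alternation `v̄₁ a₁ v̄₂ a₂ ⋯ v̄_j a_j` of valley-blocks and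
single entries. -/
def AltFromAux (π : List ℕ) : ℕ → ℕ → Prop
  | 0, i => i = π.length + 1
  | fuel + 1, i => i = π.length + 1 ∨
      ∃ j, IsValleyBlock π i j ∧ AltFromAux π fuel (i + j + 2)

/-- The suffix of `π` starting at position `i` is a (nonempty) alternation of
valley-blocks and single entries. -/
def AltDecomp (π : List ℕ) (i : ℕ) : Prop :=
  i ≤ π.length ∧ AltFromAux π (π.length + 1) i

/-- The valley-boundary `𝔅(π)`: the smallest index `i` such that the suffix
`π_i,…,π_n` is an alternation of valley-blocks and single entries, and
`π.length` if no such index exists. -/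
noncomputable def vBoundary (π : List ℕ) : ℕ :=
  if _h : ∃ i, 1 ≤ i ∧ AltDecomp π i then sInf {i | 1 ≤ i ∧ AltDecomp π i}
  else π.length

/-- The value `x` appears in the valley-region `π_{𝔅(π)},…,π_n` of `π`. -/
def InValleyRegion (π : List ℕ) (x : ℕ) : Prop :=
  ∃ i, vBoundary π ≤ i ∧ i ≤ π.length ∧ ent π i = x

/-- `π` is half-decreasing: `π_{n-1}, π_{n-3}, …` (⌊(n−1)/2⌋ entries) is the
identity `1, 2, …, ⌊(n−1)/2⌋`. -/
def HalfDecreasing (π : List ℕ) : Prop :=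
  ∀ k, 1 ≤ k → k ≤ (π.length - 1) / 2 → ent π (π.length + 1 - 2 * k) = k

/-- `π` is periodic under `s_{123,132}`. -/
def PeriodicS (π : List ℕ) : Prop := ∃ k, 1 ≤ k ∧ s132^[k] π = π

/-! ### The push test -/

lemma iso_len {t p : List ℕ} (h : isoBool t p = true) : t.length = p.length := by
  unfold isoBool at h
  simp only [Bool.and_eq_true, beq_iff_eq] at h
  exact h.1

lemma iso123 (a b c : ℕ) :
    isoBool [a, b, c] [1, 2, 3] = true ↔ (a < b ∧ a < c ∧ b < c) := by
  simp [isoBool, List.range_succ]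
  try tauto

lemma iso132 (a b c : ℕ) :
    isoBool [a, b, c] [1, 3, 2] = true ↔ (a < b ∧ a < c ∧ ¬ b < c) := by
  simp [isoBool, List.range_succ]
  try tauto

/-- The push test of the machine. -/
def passes (l : List ℕ) : Bool :=
  [[1, 2, 3], [1, 3, 2]].all (fun p => !containsPat l p)

lemma passes_fail {l : List ℕ} {a b c : ℕ} (hs : [a, b, c].Sublist l) (h1 : a < b) (h2 : a < c) :
    passes l = false := by
  by_contra hp
  simp only [Bool.not_eq_false] at hp
  simp only [passes, List.all_cons, List.all_nil, Bool.and_true, Bool.and_eq_true,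
    Bool.not_eq_true', containsPat, List.any_eq_false, List.mem_sublists] at hp
  have := hp.1 _ hs
  have h' := hp.2 _ hs
  rw [iso123] at this
  rw [iso132] at h'
  tauto

lemma passes_of {l : List ℕ}
    (h : ∀ a b c, [a, b, c].Sublist l → ¬ (a < b ∧ a < c)) : passes l = true := by
  simp only [passes, List.all_cons, List.all_nil, Bool.and_true, Bool.and_eq_true,
    Bool.not_eq_true', containsPat, List.any_eq_false, List.mem_sublists]
  constructor
  · intro t ht hi
    have := iso_len hi
    obtain ⟨a, b, c, rfl⟩ := List.length_eq_three.1 this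
    rw [iso123] at hi
    exact h a b c ht ⟨hi.1, hi.2.1⟩
  · intro t ht hi
    have := iso_len hi
    obtain ⟨a, b, c, rfl⟩ := List.length_eq_three.1 this
    rw [iso132] at hi
    exact h a b c ht ⟨hi.1, hi.2.1⟩

lemma passes_short {l : List ℕ} (hl : l.length ≤ 2) : passes l = true := by
  apply passes_of
  intro a b c hs
  have := hs.length_le
  simp at this
  omega

lemma passes_three {x m p : ℕ} (h : m < x) : passes [x, m, p] = true := by
  apply passes_of
  intro a b c hs
  have := hs.eq_of_length (by simp)
  simp at this
  omega

/-! ### Machine steps -/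

/-- The machine for the two patterns. -/
def run (i s o : List ℕ) : List ℕ := sortRun [[1, 2, 3], [1, 3, 2]] i s o

lemma run_nil (s o : List ℕ) : run [] s o = o ++ s := by
  simp [run, sortRun]

lemma run_push {x : ℕ} {r s o : List ℕ} (h : passes (x :: s) = true) :
    run (x :: r) s o = run r (x :: s) o := by
  unfold run
  rw [sortRun.eq_def]
  unfold passes at h
  simp only [h, if_true]

lemma run_pop {x y : ℕ} {r s o : List ℕ} (h : passes (x :: y :: s) = false) :
    run (x :: r) (y :: s) o = run (x :: r) s (o ++ [y]) := by
  unfold run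
  rw [sortRun.eq_def]
  unfold passes at h
  simp only [h, Bool.false_eq_true, if_false]

lemma run_perm : ∀ (N : ℕ) (i s o : List ℕ), 2 * i.length + s.length ≤ N →
    (run i s o).Perm (o ++ s ++ i) := by
  intro N
  induction N with
  | zero =>
    intro i s o h
    have h1 : i = [] := List.length_eq_zero_iff.1 (by omega)
    subst h1
    simp [run_nil]
  | succ N ih =>
    intro i s o h
    cases i with
    | nil => simp [run_nil]
    | cons x r =>
      simp only [List.length_cons] at h
      by_cases hp : passes (x :: s) = true
      · rw [run_push hp]
        refine (ih _ _ _ (by simp only [List.length_cons]; omega)).trans ?_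
        simp only [List.append_assoc, List.cons_append]
        exact List.Perm.append_left _ List.perm_middle.symm
      · cases s with
        | nil => exact absurd (passes_short (by simp)) hp
        | cons y s =>
          simp only [List.length_cons] at h
          rw [run_pop (by simpa using hp)]
          refine (ih _ _ _ (by simp only [List.length_cons]; omega)).trans ?_
          simp

lemma run_insert {x : ℕ} {r base : List ℕ} (hb : passes (x :: base) = true) :
    ∀ (S o : List ℕ), ∃ S1 S2, S = S1 ++ S2 ∧
      run (x :: r) (S ++ base) o = run r (x :: S2 ++ base) (o ++ S1) := by
  intro S
  induction S with
  | nil =>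
    intro o
    exact ⟨[], [], rfl, by simpa using run_push hb⟩
  | cons y S ih =>
    intro o
    by_cases hp : passes (x :: y :: S ++ base) = true
    · exact ⟨[], y :: S, rfl, by simpa using run_push hp⟩
    · obtain ⟨S1, S2, h1, h2⟩ := ih (o ++ [y])
      refine ⟨y :: S1, S2, by simp [h1], ?_⟩
      rw [List.cons_append, run_pop (by simpa using hp), h2]
      simp

lemma run_block {rest base : List ℕ} : ∀ (B S o : List ℕ),
    (∀ x ∈ B, passes (x :: base) = true) →
    ∃ W S', run (B ++ rest) (S ++ base) o = run rest (S' ++ base) (o ++ W) ∧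
      (W ++ S').Perm (B ++ S) := by
  intro B
  induction B with
  | nil => intro S o _; exact ⟨[], S, by simp, by simp⟩
  | cons x B ih =>
    intro S o h
    obtain ⟨S1, S2, h1, h2⟩ := run_insert (r := B ++ rest) (h x (by simp)) S o
    obtain ⟨W, S', h3, h4⟩ := ih (x :: S2) (o ++ S1) (fun z hz => h z (by simp [hz]))
    refine ⟨S1 ++ W, S', ?_, ?_⟩
    · rw [List.cons_append, h2, h3]
      simp
    · subst h1
      rw [List.append_assoc]
      refine (List.Perm.append_left S1 h4).trans ?_
      rw [List.perm_iff_count]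
      intro a
      simp only [List.count_append, List.count_cons]
      omega

lemma run_min {x p : ℕ} {r : List ℕ} (hp : x < p) : ∀ (S o : List ℕ), (∀ u ∈ S, x < u) →
    run (x :: r) (S ++ [p]) o = run r [x, p] (o ++ S) := by
  intro S
  induction S with
  | nil => intro o _; simpa using run_push (passes_short (by simp))
  | cons y S ih =>
    intro o h
    rw [List.cons_append, run_pop, ih _ (fun u hu => h u (by simp [hu]))]
    · simp
    · refine passes_fail (a := x) (b := y) (c := p) ?_ (h y (by simp)) hp
      simp

/-! ### The invariant -/

/-- Once a value `≤ t` was read, two adjacent entries contain a new minimum. -/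
def Q (t : ℕ) (l : List ℕ) : Prop :=
  ∀ a x y b, l = a ++ x :: y :: b → (∃ u ∈ a, u < x) → (∃ u ∈ a, u < y) → ∀ u ∈ a, t < u

/-- Open version of the invariant. -/
def I (t : ℕ) (O : List ℕ) : Prop := ∀ w, Q t (O ++ [w])

lemma split_end {A a b : List ℕ} {x y w : ℕ} (h : A ++ [w] = a ++ x :: y :: b) :
    (b = [] ∧ y = w ∧ A = a ++ [x]) ∨ (∃ b', b = b' ++ [w] ∧ A = a ++ x :: y :: b') := by
  rcases List.eq_nil_or_concat b with rfl | ⟨b', z, rfl⟩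
  · left
    have : A ++ [w] = (a ++ [x]) ++ [y] := by simpa using h
    obtain ⟨h1, h2⟩ := List.append_inj' this rfl
    simp at h2
    exact ⟨rfl, h2.symm, h1⟩
  · right
    have : A ++ [w] = (a ++ x :: y :: b') ++ [z] := by simpa using h
    obtain ⟨h1, h2⟩ := List.append_inj' this rfl
    simp at h2
    exact ⟨b', by simp [h2], h1⟩

lemma I_of_gt {t : ℕ} {A : List ℕ} (m : ℕ) (h : ∀ u ∈ A, t < u) : I t A ∧ I t (A ++ [m]) := by
  constructor
  · intro w a x y b he _ _ u hu
    rcases split_end he with ⟨_, _, h1⟩ | ⟨b', _, h1⟩ <;>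
    · subst h1; exact h u (by simp [hu])
  · intro w a x y b he _ _ u hu
    rcases split_end he with ⟨_, _, h1⟩ | ⟨b', _, h1⟩
    · obtain ⟨h1, _⟩ := List.append_inj' h1 rfl
      subst h1; exact h u hu
    · rcases split_end h1 with ⟨_, _, h1⟩ | ⟨b', _, h1⟩ <;>
      · subst h1; exact h u (by simp [hu])

lemma I_to_Q {t : ℕ} {O : List ℕ} (h : I t O) : Q t O := by
  intro a x y b he
  exact h 0 a x y (b ++ [0]) (by simp [he])

lemma I_snoc_min {t m : ℕ} {O : List ℕ} (hm : ∀ u ∈ O, m < u) (hQ : Q t O) : I t (O ++ [m]) := by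
  intro w a x y b he hx hy
  rcases split_end he with ⟨_, _, h1⟩ | ⟨b', _, h1⟩
  · obtain ⟨h1, h2⟩ := List.append_inj' h1 rfl
    simp at h2
    obtain ⟨u, hu, hlt⟩ := hx
    have := hm u (by rw [h1]; exact hu)
    omega
  · rcases split_end h1 with ⟨_, h2, h1⟩ | ⟨b'', _, h1⟩
    · obtain ⟨u, hu, hlt⟩ := hy
      have := hm u (by rw [h1]; simp [hu])
      omega
    · exact hQ a x y b'' h1 hx hy

lemma I_step {t m : ℕ} {O W : List ℕ} (hO : I (t + 1) O) (hmO : ∀ u ∈ O, m < u)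
    (hmW : ∀ u ∈ W, m < u) (hW : m ≤ t → W.length ≤ 1) : I (t + 1) (O ++ W ++ [m]) := by
  have hm : ∀ u ∈ O ++ W, m < u := by
    intro u hu
    rcases List.mem_append.1 hu with h | h
    · exact hmO u h
    · exact hmW u h
  by_cases hmt : m ≤ t
  · apply I_snoc_min hm
    have := hW hmt
    match W, this with
    | [], _ => simpa using I_to_Q hO
    | [z], _ => exact hO z
    | _ :: _ :: _, h => simp at h
  · refine (I_of_gt m ?_).2
    intro u hu
    have := hm u hu
    omega

lemma block_short {t m : ℕ} {pre B r : List ℕ} (hQ : Q t (pre ++ m :: (B ++ r)))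
    (hB : ∀ u ∈ B, m < u) (hm : m ≤ t) : B.length ≤ 1 := by
  match B, hB with
  | [], _ => simp
  | [z], _ => simp
  | x :: y :: B, hB =>
    exfalso
    have := hQ (pre ++ [m]) x y (B ++ r) (by simp)
      ⟨m, by simp, hB x (by simp)⟩ ⟨m, by simp, hB y (by simp)⟩ m (by simp)
    omega

lemma split_block (m : ℕ) : ∀ r : List ℕ, (m :: r).Nodup → ∃ B r', r = B ++ r' ∧ (∀ u ∈ B, m < u) ∧
    (r' = [] ∨ ∃ m' r'', r' = m' :: r'' ∧ m' < m) := by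
  intro r
  induction r with
  | nil => intro _; exact ⟨[], [], by simp⟩
  | cons x r ih =>
    intro hn
    simp only [List.nodup_cons, List.mem_cons, not_or] at hn
    by_cases hx : m < x
    · obtain ⟨B, r', h1, h2, h3⟩ := ih (by simp only [List.nodup_cons]; exact ⟨hn.1.2, hn.2.2⟩)
      refine ⟨x :: B, r', by simp [h1], ?_, h3⟩
      intro u hu
      rcases List.mem_cons.1 hu with rfl | hu
      · exact hx
      · exact h2 u hu
    · exact ⟨[], x :: r, rfl, by simp, Or.inr ⟨x, r, rfl, by have := hn.1.1; omega⟩⟩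

lemma run_main : ∀ (N : ℕ) (t p m : ℕ) (pre r O : List ℕ), r.length ≤ N →
    Q t (pre ++ m :: r) → (m :: r).Nodup → m < p → (∀ u ∈ O, m < u) → I (t + 1) O →
    Q (t + 1) (run r [m, p] O) ∧
      ∃ W m', run r [m, p] O = W ++ [m', p] ∧ (∀ u ∈ W, m' < u) ∧ m' < p := by
  intro N
  induction N with
  | zero =>
    intro t p m pre r O hl hQ hn hmp hmO hO
    have : r = [] := List.length_eq_zero_iff.1 (by omega)
    subst this
    rw [run_nil]
    refine ⟨?_, O, m, rfl, hmO, hmp⟩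
    have := I_step (W := []) hO hmO (by simp) (by simp) p
    simpa using this
  | succ N ih =>
    intro t p m pre r O hl hQ hn hmp hmO hO
    obtain ⟨B, r', rfl, hB, hr'⟩ := split_block m r hn
    have hlen := block_short hQ hB
    obtain ⟨W, S, h1, h2⟩ := run_block (rest := r') (base := [m, p]) B [] O
      (fun x hx => passes_three (hB x hx))
    simp only [List.nil_append, List.append_nil] at h1 h2
    have hWS : ∀ u ∈ W ++ S, m < u := fun u hu => hB u (h2.mem_iff.1 hu)
    have hI := I_step (W := W ++ S) hO hmO hWS (fun h => by rw [h2.length_eq]; exact hlen h)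
    have hall : ∀ u ∈ O ++ (W ++ S), m < u := by
      intro u hu
      rcases List.mem_append.1 hu with h | h
      · exact hmO u h
      · exact hWS u h
    rw [h1]
    rcases hr' with rfl | ⟨m', r'', rfl, hm'⟩
    · rw [run_nil]
      refine ⟨?_, O ++ (W ++ S), m, by simp, hall, hmp⟩
      have := hI p
      simpa using this
    · have e : S ++ [m, p] = (S ++ [m]) ++ [p] := by simp
      rw [e, run_min (by omega)]
      · refine ih t p m' (pre ++ m :: B) r'' _ ?_ ?_ ?_ (by omega) ?_ ?_
        · simp at hl; omega
        · simpa using hQ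
        · have := (List.nodup_cons.1 hn).2
          exact (List.nodup_append.1 this).2.1
        · intro u hu
          have : u ∈ O ++ (W ++ S) ∨ u = m := by
            simp at hu ⊢; tauto
          rcases this with h | h
          · have := hall u h; omega
          · omega
        · simpa using hI
      · intro u hu
        rcases List.mem_append.1 hu with h | h
        · have := hWS u (by simp [h]); omega
        · simp at h; omega

lemma s132_eq (π : List ℕ) : s132 π = run π [] [] := rfl

lemma s132_perm (π : List ℕ) : (s132 π).Perm π := by
  rw [s132_eq]
  simpa using run_perm _ π [] [] le_rfl

lemma s132_main {t p : ℕ} {r : List ℕ} (hn : (p :: r).Nodup) (hQ : Q t (p :: r)) :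
    Q (t + 1) (s132 (p :: r)) ∧
      (((∀ u ∈ r, p < u) ∧ ∃ W, s132 (p :: r) = W ++ [p]) ∨
      ∃ W m', s132 (p :: r) = W ++ [m', p] ∧ (∀ u ∈ W, m' < u) ∧ m' < p) := by
  rw [s132_eq, run_push (passes_short (by simp))]
  obtain ⟨B, r', rfl, hB, hr'⟩ := split_block p r hn
  have hlen := block_short (pre := []) hQ hB
  obtain ⟨W, S, h1, h2⟩ := run_block (rest := r') (base := [p]) B [] []
    (fun x hx => passes_short (by simp))
  simp only [List.nil_append, List.append_nil] at h1 h2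
  have hWS : ∀ u ∈ W ++ S, p < u := fun u hu => hB u (h2.mem_iff.1 hu)
  have hI : I (t + 1) (W ++ S) := by
    by_cases hp : p ≤ t
    · have := hlen hp
      rw [← h2.length_eq] at this
      intro w a x y b he _ _ u hu
      have h := congrArg List.length he
      have h' := List.length_pos_of_mem hu
      simp only [List.length_append, List.length_cons, List.length_nil] at h this
      omega
    · refine (I_of_gt 0 ?_).1
      intro u hu
      have := hWS u hu
      omega
  rw [h1]
  rcases hr' with rfl | ⟨m', r'', rfl, hm'⟩
  · rw [run_nil]
    refine ⟨?_, Or.inl ⟨by simpa using hB, W ++ S, by simp⟩⟩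
    have := hI p
    simpa using this
  · rw [run_min hm']
    · have := run_main _ t p m' (p :: B) r'' (W ++ S) le_rfl (by simpa using hQ) ?_ hm' ?_ hI
      · exact ⟨this.1, Or.inr this.2⟩
      · exact (List.nodup_append.1 (List.nodup_cons.1 hn).2).2.1
      · intro u hu
        have := hWS u hu
        omega
    · intro u hu
      have := hWS u (by simp [hu])
      omega

lemma iter_perm (π : List ℕ) : ∀ t, (s132^[t] π).Perm π := by
  intro t
  induction t with
  | zero => simp
  | succ t ih => rw [Function.iterate_succ_apply']; exact (s132_perm _).trans ih

lemma iter_Q {π : List ℕ} (hn : π.Nodup) (h0 : ∀ u ∈ π, 1 ≤ u) : ∀ t, Q t (s132^[t] π) := by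
  intro t
  induction t with
  | zero =>
    intro a x y b he _ _ u hu
    simp only [Function.iterate_zero, id] at he
    exact h0 u (by rw [he]; simp [hu])
  | succ t ih =>
    rw [Function.iterate_succ_apply']
    have hp := iter_perm π t
    have hn' := hp.nodup_iff.2 hn
    rcases hs : s132^[t] π with _ | ⟨p, r⟩
    · intro a x y b he
      have h := congrArg List.length he
      rw [(s132_perm []).length_eq] at h
      simp at h
    · rw [hs] at ih hn'
      exact (s132_main hn' ih).1

/-- The list ends in its minimum followed by one entry. -/
def EndsMin (l : List ℕ) : Prop := ∃ W m p, l = W ++ [m, p] ∧ (∀ u ∈ W, m < u) ∧ m < p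

/-- The list ends in its minimum. -/
def EndsMin' (l : List ℕ) : Prop := ∃ W p, l = W ++ [p] ∧ (∀ u ∈ W, p < u)

lemma s132_ends {π : List ℕ} (hn : π.Nodup) (h0 : ∀ u ∈ π, 1 ≤ u) (hne : π ≠ []) :
    EndsMin (s132 π) ∨ EndsMin' (s132 π) := by
  rcases π with _ | ⟨p, r⟩
  · simp at hne
  have hQ : Q 0 (p :: r) := iter_Q hn h0 0
  rcases (s132_main hn hQ).2 with ⟨h1, W, hW⟩ | ⟨W, m, h⟩
  · right
    refine ⟨W, p, hW, ?_⟩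
    intro u hu
    have hp := s132_perm (p :: r)
    rw [hW] at hp
    have hp' : W.Perm r := by
      have : (p :: W).Perm (p :: r) := (List.perm_append_singleton p W).symm.trans hp
      exact List.Perm.cons_inv this
    exact h1 u (hp'.mem_iff.1 hu)
  · exact Or.inl ⟨W, m, p, h⟩

lemma s132_ends2 {π : List ℕ} (hn : π.Nodup) (h0 : ∀ u ∈ π, 1 ≤ u) (hl : 3 ≤ π.length)
    (he : EndsMin π ∨ EndsMin' π) : EndsMin (s132 π) := by
  rcases π with _ | ⟨p, r⟩
  · simp at hl
  have hQ : Q 0 (p :: r) := iter_Q hn h0 0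
  rcases (s132_main hn hQ).2 with ⟨h1, W, hW⟩ | ⟨W, m, h⟩
  · exfalso
    rcases he with ⟨W, m, q, h, h2, h3⟩ | ⟨W, m, h, h2⟩
    · rcases W with _ | ⟨w, W⟩
      · rw [h] at hl; simp at hl
      · simp only [List.cons_append, List.cons.injEq] at h
        have e1 := h2 w (by simp)
        have e2 := h1 m (by rw [h.2]; simp)
        omega
    · rcases W with _ | ⟨w, W⟩
      · rw [h] at hl; simp at hl
      · simp only [List.cons_append, List.cons.injEq] at h
        have e1 := h2 w (by simp)
        have e2 := h1 m (by rw [h.2]; simp)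
        omega
  · exact ⟨W, m, p, h⟩

/-! ### Positions -/

lemma ent_get {π : List ℕ} {i : ℕ} (h1 : 1 ≤ i) (h2 : i ≤ π.length) :
    ent π i = π[i - 1]'(by omega) := by
  unfold ent
  exact List.getD_eq_getElem _ _ _

lemma ent_inj {π : List ℕ} (hn : π.Nodup) {i j : ℕ} (h1 : 1 ≤ i) (h2 : i ≤ π.length)
    (h3 : 1 ≤ j) (h4 : j ≤ π.length) (h : ent π i = ent π j) : i = j := by
  rw [ent_get h1 h2, ent_get h3 h4] at h
  have := (List.Nodup.getElem_inj_iff hn).1 h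
  omega

lemma Q_idx {t : ℕ} {π : List ℕ} (hQ : Q t π) {j k : ℕ} (hj : 1 ≤ j) (hjk : j < k)
    (hk : k + 1 ≤ π.length) (ht : ent π j ≤ t) (hnk : ¬ IsLtrMin π k) : IsLtrMin π (k + 1) := by
  by_contra hnk'
  have mem : ∀ u, 1 ≤ u → u < k → ent π u ∈ π.take (k - 1) := by
    intro u h1 h2
    rw [ent_get h1 (by omega), List.mem_take_iff_getElem]
    exact ⟨u - 1, by omega, rfl⟩
  have hx : ∃ u, 1 ≤ u ∧ u < k ∧ ent π u < ent π k := by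
    by_contra hc
    push Not at hc
    apply hnk
    refine ⟨by omega, by omega, fun m h1 h2 => ?_⟩
    rcases Nat.lt_or_ge m k with h | h
    · exact hc m h1 h
    · have : m = k := by omega
      rw [this]
  have hy : ∃ u, 1 ≤ u ∧ u < k ∧ ent π u < ent π (k + 1) := by
    by_contra hc
    push Not at hc
    apply hnk'
    refine ⟨by omega, by omega, fun m h1 h2 => ?_⟩
    rcases Nat.lt_or_ge m k with h | h
    · exact hc m h1 h
    · rcases Nat.eq_or_lt_of_le h with h | h
      · subst h
        obtain ⟨u, hu1, hu2, hu3⟩ := hx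
        exact (hc u hu1 hu2).trans hu3.le
      · have : m = k + 1 := by omega
        rw [this]
  have hdec : π = π.take (k - 1) ++ ent π k :: ent π (k + 1) :: π.drop (k + 1) := by
    rw [ent_get (i := k) (by omega) (by omega), ent_get (i := k + 1) (by omega) (by omega)]
    have e1 := List.drop_eq_getElem_cons (l := π) (i := k - 1) (by omega)
    have e2 := List.drop_eq_getElem_cons (l := π) (i := k) (by omega)
    have e3 : k - 1 + 1 = k := by omega
    rw [e3, e2] at e1
    simp only [Nat.add_sub_cancel]
    rw [← e1, List.take_append_drop]
  obtain ⟨u, hu1, hu2, hu3⟩ := hx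
  obtain ⟨v, hv1, hv2, hv3⟩ := hy
  have := hQ _ _ _ _ hdec ⟨_, mem u hu1 hu2, hu3⟩ ⟨_, mem v hv1 hv2, hv3⟩ _ (mem j hj hjk)
  omega

lemma alt_of_Q {t : ℕ} {π : List ℕ} (hn : π.Nodup) (hQ : Q t π)
    (hlast : ¬ IsLtrMin π π.length) : ∀ (fuel p : ℕ), IsLtrMin π p → ent π p ≤ t →
    π.length + 1 - p ≤ fuel → AltFromAux π fuel p := by
  intro fuel
  induction fuel using Nat.strong_induction_on with
  | _ fuel ih =>
  intro p hp ht hf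
  obtain ⟨hp1, hp2, hp3⟩ := hp
  have hex : ∃ q, p < q ∧ q ≤ π.length ∧ ¬ IsLtrMin π q := by
    refine ⟨π.length, ?_, le_rfl, hlast⟩
    rcases Nat.eq_or_lt_of_le hp2 with h | h
    · exact absurd (h ▸ ⟨hp1, hp2, hp3⟩) hlast
    · exact h
  obtain ⟨hq1, hq2, hq3⟩ := Nat.find_spec hex
  have hmin : ∀ k, p ≤ k → k < Nat.find hex → IsLtrMin π k := by
    intro k h1 h2
    rcases Nat.eq_or_lt_of_le h1 with h | h
    · subst h; exact ⟨hp1, hp2, hp3⟩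
    · by_contra hc
      exact Nat.find_min hex h2 ⟨h, by omega, hc⟩
  generalize Nat.find hex = q at *
  have hnext : q + 1 ≤ π.length → IsLtrMin π (q + 1) := fun h => Q_idx hQ hp1 hq1 h ht hq3
  obtain ⟨f, rfl⟩ : ∃ f, fuel = f + 1 := ⟨fuel - 1, by omega⟩
  right
  refine ⟨q - 1 - p, ?_, ?_⟩
  · have e : p + (q - 1 - p) = q - 1 := by omega
    have e1 : q - 1 + 1 = q := by omega
    have e2 : q - 1 + 2 = q + 1 := by omega
    unfold IsValleyBlock IsValley
    rw [e, e1, e2]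
    refine ⟨hp1, by omega, ⟨hmin _ (by omega) (by omega), fun _ => hq3, hnext⟩, ?_, ?_⟩
    · intro k h1 h2
      have := (hmin (k + 1) (by omega) (by omega)).2.2 k (by omega) (by omega)
      rcases Nat.eq_or_lt_of_le this with h | h
      · have := ent_inj hn (by omega) (by omega) (by omega) (by omega) h
        omega
      · exact h
    · intro k h1 h2
      rcases Nat.eq_or_lt_of_le (hp3 k h1 (by omega)) with h | h
      · have := ent_inj hn (by omega) (by omega) (by omega) (by omega) h
        omega
      · exact h
  · have e : p + (q - 1 - p) + 2 = q + 1 := by omega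
    rw [e]
    rcases Nat.eq_or_lt_of_le hq2 with h | h
    · rw [h]
      cases f with
      | zero => rfl
      | succ f => exact Or.inl rfl
    · have hl := hnext h
      exact ih f (by omega) (q + 1) hl ((hl.2.2 p hp1 (by omega)).trans ht) (by omega)

lemma vB_le {π : List ℕ} {i : ℕ} (h1 : 1 ≤ i) (h : AltDecomp π i) : vBoundary π ≤ i := by
  unfold vBoundary
  rw [dif_pos ⟨i, h1, h⟩]
  exact Nat.sInf_le ⟨h1, h⟩

lemma vB_le_length (π : List ℕ) : vBoundary π ≤ π.length := by
  by_cases h : ∃ i, 1 ≤ i ∧ AltDecomp π i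
  · obtain ⟨i, h1, h2⟩ := h
    exact (vB_le h1 h2).trans h2.1
  · unfold vBoundary
    rw [dif_neg h]

lemma exists_ltr (π : List ℕ) : ∀ i, 1 ≤ i → i ≤ π.length →
    ∃ p, p ≤ i ∧ IsLtrMin π p ∧ ent π p ≤ ent π i := by
  intro i
  induction i using Nat.strong_induction_on with
  | _ i ih =>
  intro h1 h2
  by_cases h : IsLtrMin π i
  · exact ⟨i, le_rfl, h, le_rfl⟩
  · unfold IsLtrMin at h
    push Not at h
    obtain ⟨m, hm1, hm2, hm3⟩ := h h1 h2
    have : m ≠ i := by rintro rfl; omega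
    obtain ⟨p, hp1, hp2, hp3⟩ := ih m (by omega) hm1 (by omega)
    exact ⟨p, by omega, hp2, by omega⟩

lemma final_case {t : ℕ} {π : List ℕ} (hn : π.Nodup) (hQ : Q t π) (he : EndsMin π) {i : ℕ}
    (h1 : 1 ≤ i) (h2 : i ≤ π.length) (ht : ent π i ≤ t) : vBoundary π ≤ i := by
  have hlast : ¬ IsLtrMin π π.length := by
    obtain ⟨W, m, p, rfl, _, hmp⟩ := he
    intro h
    have := h.2.2 (W.length + 1) (by omega) (by simp)
    simp [ent, List.getD_eq_getElem?_getD] at this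
    omega
  obtain ⟨p, hp1, hp2, hp3⟩ := exists_ltr π i h1 h2
  refine (vB_le hp2.1 ⟨hp2.2.1, ?_⟩).trans hp1
  exact alt_of_Q hn hQ hlast _ p hp2 (by omega) (by omega)

/-- for any `π` in the image of `s_{123,132}^{⌊(n-1)/2⌋}`, every
small entry lies in the valley-region: `π_i ≤ ⌊(n-1)/2⌋` implies `i ≥ 𝔅(π)`. -/
theorem stmt6 (n : ℕ) (π0 : List ℕ) (hπ0 : IsPermOf n π0) (i : ℕ)
    (h1 : 1 ≤ i) (h2 : i ≤ n)
    (hsmall : ent (s132^[(n - 1) / 2] π0) i ≤ (n - 1) / 2) :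
    vBoundary (s132^[(n - 1) / 2] π0) ≤ i := by
  have hn0 : π0.Nodup := by
    refine hπ0.nodup_iff.2 ?_
    exact List.nodup_range.map (fun a b h => by simpa using h)
  have h0 : ∀ u ∈ π0, 1 ≤ u := by
    intro u hu
    have := hπ0.mem_iff.1 hu
    simp at this
    omega
  have hlen0 : π0.length = n := by simpa using hπ0.length_eq
  have facts : ∀ t, (s132^[t] π0).Nodup ∧ (∀ u ∈ s132^[t] π0, 1 ≤ u) ∧
      (s132^[t] π0).length = n := by
    intro t
    have hp := iter_perm π0 t
    exact ⟨hp.nodup_iff.2 hn0, fun u hu => h0 u (hp.mem_iff.1 hu), hp.length_eq.trans hlen0⟩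
  have hQ := iter_Q hn0 h0 ((n - 1) / 2)
  obtain ⟨f1, f2, f3⟩ := facts ((n - 1) / 2)
  have hpos : 1 ≤ ent (s132^[(n - 1) / 2] π0) i := by
    rw [ent_get h1 (by omega)]
    exact f2 _ (List.getElem_mem _)
  have hends : ∀ t, EndsMin (s132^[t + 1] π0) ∨ EndsMin' (s132^[t + 1] π0) := by
    intro t
    rw [Function.iterate_succ_apply']
    obtain ⟨g1, g2, g3⟩ := facts t
    exact s132_ends g1 g2 (by intro h; rw [h] at g3; simp at g3; omega)
  have hends2 : ∀ t, EndsMin (s132^[t + 2] π0) := by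
    intro t
    rw [Function.iterate_succ_apply']
    obtain ⟨g1, g2, g3⟩ := facts (t + 1)
    exact s132_ends2 g1 g2 (by omega) (hends t)
  rcases Nat.lt_or_ge ((n - 1) / 2) 2 with hT | hT
  · have hT1 : (n - 1) / 2 = 0 + 1 := by omega
    have he := hends 0
    rw [← hT1] at he
    rcases he with he | he
    · exact final_case f1 hQ he h1 (by omega) hsmall
    · have hi : i = n := by
        obtain ⟨W, p, hW, hlt⟩ := he
        by_contra hc
        rw [hW] at f3 f2 hsmall
        simp only [List.length_append, List.length_cons, List.length_nil] at f3
        rw [ent_get h1 (by simp; omega), List.getElem_append_left (by omega)] at hsmall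
        have := hlt _ (List.getElem_mem (l := W) (n := i - 1) (by omega))
        have := f2 p (by simp)
        omega
      have := vB_le_length (s132^[(n - 1) / 2] π0)
      omega
  · obtain ⟨t, ht⟩ : ∃ t, (n - 1) / 2 = t + 2 := ⟨(n - 1) / 2 - 2, by omega⟩
    have he := hends2 t
    rw [← ht] at he
    exact final_case f1 hQ he h1 (by omega) hsmall
end

section
/- A permutation π ∈ Sₙ is periodic under s_{123,132} (that is, s_{123,132}^k(π) = π for some positive integer k) if and only if π is half-decreasing. -/
open scoped Classical

/-- The forbidden configuration: an entry with two larger entries below it. -/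
def Bad (l : List ℕ) : Prop := ∃ a b c, List.Sublist [a, b, c] l ∧ a < b ∧ a < c

/-- The patterns `123` and `132`. -/
abbrev Pats : List (List ℕ) := [[1, 2, 3], [1, 3, 2]]

lemma iso_123 (t : List ℕ) : isoBool t [1, 2, 3] = true ↔
    ∃ a b c, t = [a, b, c] ∧ a < b ∧ a < c ∧ b < c := by
  rcases t with _ | ⟨a, _ | ⟨b, _ | ⟨c, _ | ⟨d, t⟩⟩⟩⟩ <;>
    simp [isoBool, List.range_succ]
  tauto

lemma iso_132 (t : List ℕ) : isoBool t [1, 3, 2] = true ↔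
    ∃ a b c, t = [a, b, c] ∧ a < b ∧ a < c ∧ ¬ b < c := by
  rcases t with _ | ⟨a, _ | ⟨b, _ | ⟨c, _ | ⟨d, t⟩⟩⟩⟩ <;>
    simp [isoBool, List.range_succ]
  tauto

lemma pats_iff (l : List ℕ) :
    (Pats.all (fun p => !containsPat l p)) = true ↔ ¬ Bad l := by
  rw [← not_iff_not, not_not]
  have h : ¬ (Pats.all (fun p => !containsPat l p)) = true ↔
      (∃ t, t.Sublist l ∧ isoBool t [1, 2, 3] = true) ∨
      (∃ t, t.Sublist l ∧ isoBool t [1, 3, 2] = true) := by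
    simp only [Pats, List.all_cons, List.all_nil, containsPat, Bool.and_true, Bool.and_eq_true,
      Bool.not_eq_true', not_and_or, Bool.not_eq_false, List.any_eq_true, List.mem_sublists]
  rw [h]
  simp only [iso_123, iso_132]
  constructor
  · rintro (⟨t, ht, a, b, c, rfl, h1, h2, h3⟩ | ⟨t, ht, a, b, c, rfl, h1, h2, h3⟩) <;>
      exact ⟨a, b, c, ht, h1, h2⟩
  · rintro ⟨a, b, c, ht, h1, h2⟩
    by_cases h3 : b < c
    · exact Or.inl ⟨_, ht, a, b, c, rfl, h1, h2, h3⟩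
    · exact Or.inr ⟨_, ht, a, b, c, rfl, h1, h2, h3⟩

lemma run_nil_s10 (st out : List ℕ) : sortRun Pats [] st out = out ++ st := by
  rw [sortRun]

lemma run_push_s10 (x : ℕ) (rest st out : List ℕ) (h : ¬ Bad (x :: st)) :
    sortRun Pats (x :: rest) st out = sortRun Pats rest (x :: st) out := by
  rw [sortRun.eq_def]
  dsimp only
  rw [if_pos ((pats_iff _).2 h)]

lemma run_pop_s10 (x y : ℕ) (rest st out : List ℕ) (h : Bad (x :: y :: st)) :
    sortRun Pats (x :: rest) (y :: st) out = sortRun Pats (x :: rest) st (out ++ [y]) := by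
  rw [sortRun, if_neg (fun h' => (pats_iff _).1 h' h)]

lemma Bad.mono {l l' : List ℕ} (h : l.Sublist l') (hb : Bad l) : Bad l' := by
  obtain ⟨a, b, c, hs, h1⟩ := hb
  exact ⟨a, b, c, hs.trans h, h1⟩

lemma not_bad_short (l : List ℕ) (h : l.length ≤ 2) : ¬ Bad l := by
  rintro ⟨a, b, c, hs, -⟩
  have := hs.length_le
  simp at this
  omega

lemma not_bad_three (x y z : ℕ) (h : ¬ (x < y ∧ x < z)) : ¬ Bad [x, y, z] := by
  rintro ⟨a, b, c, hs, h1, h2⟩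
  have := hs.eq_of_length (by simp)
  simp at this
  obtain ⟨rfl, rfl, rfl⟩ := this
  exact h ⟨h1, h2⟩

/-- Processing `inp` above a part `bot` of the stack that is never popped. -/
lemma run_main_s10 (bot : List ℕ) : ∀ (N : ℕ) (inp st out : List ℕ),
    2 * inp.length + st.length ≤ N → ¬ Bad (st ++ bot) → (∀ x ∈ inp, ¬ Bad (x :: bot)) →
    ∃ B st', (B ++ st').Perm (inp ++ st) ∧ ¬ Bad (st' ++ bot) ∧
      ∀ rest, sortRun Pats (inp ++ rest) (st ++ bot) out =
        sortRun Pats rest (st' ++ bot) (out ++ B) := by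
  intro N
  induction N with
  | zero =>
    intro inp st out hN hb hx
    obtain rfl : inp = [] := List.length_eq_zero_iff.1 (by omega)
    exact ⟨[], st, by simp, hb, by simp⟩
  | succ N ih =>
    intro inp st out hN hb hx
    rcases inp with _ | ⟨x, inp⟩
    · exact ⟨[], st, by simp, hb, by simp⟩
    by_cases hbad : Bad (x :: (st ++ bot))
    · rcases st with _ | ⟨y, st⟩
      · exact absurd hbad (hx x (by simp))
      · obtain ⟨B, st', hp, hb', hr⟩ := ih (x :: inp) st (out ++ [y])
          (by simp at hN ⊢; omega)
          (fun h => hb (h.mono (by simp))) hx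
        refine ⟨y :: B, st', ?_, hb', ?_⟩
        · have := hp.cons y
          refine this.trans ?_
          exact List.perm_middle.symm
        · intro rest
          have := hr rest
          simp only [List.cons_append] at this ⊢
          rw [run_pop_s10 _ _ _ _ _ (by simpa using hbad), this]
          simp
    · obtain ⟨B, st', hp, hb', hr⟩ := ih inp (x :: st) out
        (by simp at hN ⊢; omega) hbad (fun z hz => hx z (by simp [hz]))
      refine ⟨B, st', hp.trans (by simpa using List.perm_middle), hb', ?_⟩
      intro rest
      have := hr rest
      simp only [List.cons_append] at this ⊢
      rw [run_push_s10 _ _ _ _ hbad, this]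

lemma run_popall (m c : ℕ) (hc : m < c) (rest : List ℕ) : ∀ (st out : List ℕ),
    (∀ x ∈ st, m < x) →
    sortRun Pats (m :: rest) (st ++ [c]) out = sortRun Pats rest [m, c] (out ++ st) := by
  intro st
  induction st with
  | nil =>
    intro out _
    simp only [List.nil_append, List.append_nil]
    rw [run_push_s10 _ _ _ _ (not_bad_short _ (by simp))]
  | cons y st ih =>
    intro out h
    simp only [List.cons_append]
    rw [run_pop_s10, ih _ (fun x hx => h x (by simp [hx]))]
    · simp
    · exact ⟨m, y, c, by simp, h y (by simp), hc⟩

/-- `m, a_m, m-1, a_{m-1}, …, 1, a_1` from `a_m, …, a_1`. -/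
def build : List ℕ → List ℕ
  | [] => []
  | a :: q => (q.length + 1) :: a :: build q

/-- `a_m, m, …, a_1, 1, c`. -/
def tailf : List ℕ → ℕ → List ℕ
  | [], c => [c]
  | a :: q, c => a :: (q.length + 1) :: tailf q c

lemma tailf_cons (q : List ℕ) : ∀ a c, tailf (a :: q) c = a :: build (q ++ [c]) := by
  induction q with
  | nil => intro a c; simp [tailf, build]
  | cons b q ih =>
    intro a c
    rw [tailf, ih]
    simp [build]

lemma tailf_eq (q : List ℕ) (c h : ℕ) (t : List ℕ) (e : q ++ [c] = h :: t) :
    tailf q c = h :: build t := by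
  rcases q with _ | ⟨a, q⟩
  · simp at e
    obtain ⟨rfl, rfl⟩ := e
    simp [tailf, build]
  · simp at e
    obtain ⟨rfl, rfl⟩ := e
    rw [tailf_cons]

lemma run_build (c : ℕ) : ∀ (q st out : List ℕ), q.length < c → (∀ x ∈ st, q.length < x) →
    (∀ x ∈ q, q.length < x) →
    sortRun Pats (build q) (st ++ [c]) out = out ++ st ++ tailf q c := by
  intro q
  induction q with
  | nil => intro st out _ _ _; simp [build, tailf, run_nil_s10]
  | cons a q ih =>
    intro st out hc hst hq
    simp only [List.length_cons] at hc hst hq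
    have ha := hq a (by simp)
    rw [build, run_popall _ _ hc _ _ _ hst,
      run_push_s10 _ _ _ _ (not_bad_three _ _ _ (by omega))]
    have := ih [a, q.length + 1] (out ++ st) (by omega) (by simp; omega)
      (fun x hx => by have := hq x (by simp [hx]); omega)
    simp only [List.cons_append, List.nil_append] at this
    rw [this, tailf]
    simp

lemma step_gen (c : ℕ) (A q : List ℕ) (hc : q.length < c) (hA : ∀ x ∈ A, q.length < x)
    (hq : ∀ x ∈ q, q.length < x) :
    ∃ D, D.Perm A ∧ s132 ((c :: A) ++ build q) = D ++ tailf q c := by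
  obtain ⟨B, st', hp, -, hr⟩ := run_main_s10 [c] _ A [] [] le_rfl
    (not_bad_short _ (by simp)) (fun x _ => not_bad_short _ (by simp))
  simp only [List.append_nil] at hp
  refine ⟨B ++ st', hp, ?_⟩
  have h1 := hr (build q)
  simp only [List.nil_append] at h1
  have : s132 ((c :: A) ++ build q) = sortRun Pats (A ++ build q) [c] [] := by
    rw [s132, sortT, List.cons_append]
    exact run_push_s10 _ _ _ _ (not_bad_short _ (by simp))
  rw [this, h1, run_build c q st' B hc _ hq]
  intro x hx
  exact hA x (hp.subset (by simp [hx]))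

lemma step_up (c μ : ℕ) (A q : List ℕ) (hμ : q.length < μ) (hA : ∀ x ∈ A, μ ≤ x)
    (hn : A.Nodup) (hc : μ < c)
    (hq : ∀ x ∈ q, q.length < x) (hm : μ ∈ A) :
    ∃ D, (μ :: D).Perm A ∧ s132 ((c :: A) ++ build q) = D ++ μ :: tailf q c := by
  obtain ⟨A1, A2, rfl⟩ := List.append_of_mem hm
  obtain ⟨B, st', hp, -, hr⟩ := run_main_s10 [c] _ A1 [] [] le_rfl
    (not_bad_short _ (by simp)) (fun x _ => not_bad_short _ (by simp))
  simp only [List.append_nil] at hp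
  obtain ⟨B2, st2, hp2, -, hr2⟩ := run_main_s10 [μ, c] _ A2 [] (B ++ st') le_rfl
    (not_bad_short _ (by simp)) (fun x hx => not_bad_three _ _ _ (by
      have := hA x (by simp [hx])
      omega))
  simp only [List.append_nil] at hp2
  have : s132 ((c :: (A1 ++ μ :: A2)) ++ build q)
      = sortRun Pats (A1 ++ (μ :: (A2 ++ build q))) [c] [] := by
    rw [s132, sortT, List.cons_append,  run_push_s10 _ _ _ _ (not_bad_short _ (by simp))]
    simp
  have h1 := hr (μ :: (A2 ++ build q))
  simp only [List.nil_append] at h1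
  have h2 := hr2 (build q)
  simp only [List.nil_append] at h2
  have hst : ∀ x ∈ st', μ < x := by
    intro x hx
    have hx1 : x ∈ A1 := hp.subset (by simp [hx])
    have h3 := hA x (by simp [hx1])
    have : x ≠ μ := by
      rintro rfl
      have := (List.nodup_append.1 hn).2.2 x hx1 x (by simp)
      exact this rfl
    omega
  refine ⟨B ++ st' ++ B2 ++ st2, ?_, ?_⟩
  · refine List.Perm.trans ?_ List.perm_middle.symm
    refine List.Perm.cons μ ?_
    rw [List.append_assoc (B ++ st')]
    exact hp.append hp2
  · rw [this, h1, run_popall _ _ hc _ _ _ hst, h2]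
    have h4 := run_build c q (st2 ++ [μ]) (B ++ st' ++ B2) (by omega) (by
      intro x hx
      simp at hx
      rcases hx with hx | rfl
      · have : x ∈ A2 := hp2.subset (by simp [hx])
        have := hA x (by simp [this])
        omega
      · exact hμ) hq
    simp only [List.append_assoc, List.cons_append, List.nil_append] at h4 ⊢
    rw [h4]

/-- `L` encodes the state `(A, q)` at level `m`. -/
def St (n m : ℕ) (A q : List ℕ) : Prop :=
  q.length = m ∧ A ≠ [] ∧ (A ++ q).Perm (List.range' (m + 1) (n - m))

lemma St.gt {n m : ℕ} {A q : List ℕ} (h : St n m A q) {x : ℕ} (hx : x ∈ A ++ q) : m < x := by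
  have := h.2.2.subset hx
  simp at this
  omega

lemma St.step {n m c : ℕ} {A q : List ℕ} (h : St n m (c :: A) q) {hd : ℕ} {t : List ℕ}
    (e : q ++ [c] = hd :: t) :
    ∃ D, D.Perm A ∧ s132 ((c :: A) ++ build q) = (D ++ [hd]) ++ build t ∧
      St n m (D ++ [hd]) t := by
  obtain ⟨D, hD, hs⟩ := step_gen c A q (by rw [h.1]; exact h.gt (by simp))
    (fun x hx => by rw [h.1]; exact h.gt (by simp [hx]))
    (fun x hx => by rw [h.1]; exact h.gt (by simp [hx]))
  refine ⟨D, hD, ?_, ?_, by simp, ?_⟩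
  · rw [hs, tailf_eq q c hd t e]; simp
  · have := congrArg List.length e
    simp at this
    rw [← this]; exact h.1
  · rw [List.append_assoc, List.singleton_append, ← e]
    refine List.Perm.trans ?_ h.2.2
    refine (hD.append_right _).trans ?_
    rw [← List.append_assoc]
    simpa using List.perm_append_singleton c (A ++ q)

lemma St.up {n m c : ℕ} {A q : List ℕ} (h : St n m (c :: A) q) (hA : 2 ≤ A.length)
    (hm : m + 1 ∈ A) :
    ∃ D q', s132 ((c :: A) ++ build q) = D ++ build q' ∧ St n (m + 1) D q' := by
  have hnd : (c :: (A ++ q)).Nodup := h.2.2.nodup_iff.2 (List.nodup_range')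
  have hcne : c ≠ m + 1 := by
    rintro rfl
    exact (List.nodup_cons.1 hnd).1 (by simp [hm])
  have hcgt : m < c := h.gt (by simp)
  obtain ⟨D, hD, hs⟩ := step_up c (m + 1) A q (by rw [h.1]; omega)
    (fun x hx => h.gt (by simp [hx]))
    (List.nodup_append.1 (List.nodup_cons.1 hnd).2).1 (by omega)
    (fun x hx => by rw [h.1]; exact h.gt (by simp [hx])) hm
  obtain ⟨hd, t, e⟩ : ∃ hd t, q ++ [c] = hd :: t := by
    rcases q with _ | ⟨a, q⟩
    · exact ⟨_, _, rfl⟩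
    · exact ⟨_, _, rfl⟩
  have hlen := congrArg List.length e
  simp at hlen
  have hq := h.1
  refine ⟨D, hd :: t, ?_, ?_, ?_, ?_⟩
  · rw [hs, tailf_eq q c hd t e, build, ← hlen, h.1]
  · simp; omega
  · rintro rfl
    have := hD.length_eq
    simp at this
    omega
  · rw [← e]
    have h3 : ((m + 1) :: (D ++ (q ++ [c]))).Perm (List.range' (m + 1) (n - m)) := by
      refine List.Perm.trans ?_ h.2.2
      rw [← List.cons_append]
      refine (hD.append_right _).trans ?_
      rw [← List.append_assoc]
      simpa using List.perm_append_singleton c (A ++ q)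
    have h4 : n - m = (n - (m + 1)) + 1 := by
      have := h3.length_eq
      simp at this
      omega
    rw [h4, List.range'_succ] at h3
    exact (List.perm_cons _).1 h3

lemma St.len {n m : ℕ} {A q : List ℕ} (h : St n m A q) : A.length + 2 * m = n := by
  have := h.2.2.length_eq
  have h2 := h.1
  have := List.length_pos_of_ne_nil h.2.1
  simp at *
  omega

/-- Some iterate of `L` is a state of level `m`. -/
def Reach (n m : ℕ) (L : List ℕ) : Prop :=
  ∃ k A q, s132^[k] L = A ++ build q ∧ St n m A q

lemma Reach.of_step {n m : ℕ} {L : List ℕ} (h : Reach n m (s132 L)) : Reach n m L := by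
  obtain ⟨k, A, q, e, h⟩ := h
  exact ⟨k + 1, A, q, by simpa using e, h⟩

lemma reach_A {n m c : ℕ} {A q : List ℕ} (h : St n m (c :: A) q) (hA : 2 ≤ A.length)
    (hm : m + 1 ∈ A) : Reach n (m + 1) ((c :: A) ++ build q) := by
  obtain ⟨D, q', e, h'⟩ := h.up hA hm
  exact ⟨1, D, q', by simpa using e, h'⟩

lemma reach_q {n m : ℕ} : ∀ (q1 : List ℕ) (c : ℕ) (A q2 : List ℕ),
    St n m (c :: A) (q1 ++ (m + 1) :: q2) → 2 ≤ A.length →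
    Reach n (m + 1) ((c :: A) ++ build (q1 ++ (m + 1) :: q2)) := by
  intro q1
  induction q1 with
  | nil =>
    intro c A q2 h hA
    obtain ⟨D, hD, hs, h'⟩ := h.step (hd := m + 1) (t := q2 ++ [c]) (by simp)
    apply Reach.of_step
    rw [hs]
    have := hD.length_eq
    rcases D with _ | ⟨d, D⟩
    · simp at this; omega
    · exact reach_A (A := D ++ [m + 1]) h' (by simp at *; omega) (by simp)
  | cons a q1 ih =>
    intro c A q2 h hA
    obtain ⟨D, hD, hs, h'⟩ := h.step (hd := a) (t := q1 ++ (m + 1) :: (q2 ++ [c])) (by simp)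
    apply Reach.of_step
    rw [hs]
    have := hD.length_eq
    rcases D with _ | ⟨d, D⟩
    · simp at this; omega
    · exact ih d (D ++ [a]) _ h' (by simp at *; omega)

lemma reach_succ {n m : ℕ} {A q : List ℕ} (h : St n m A q) (hA : 3 ≤ A.length) :
    Reach n (m + 1) (A ++ build q) := by
  rcases A with _ | ⟨c, A⟩
  · simp at hA
  have hA' : 2 ≤ A.length := by simp at hA; omega
  have hlen := h.len
  have hmem : m + 1 ∈ (c :: A) ++ q := h.2.2.symm.subset (by simp; omega)
  rw [List.mem_append, List.mem_cons] at hmem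
  rcases hmem with (rfl | hm) | hm
  · rcases q with _ | ⟨a, q⟩
    · obtain ⟨D, hD, hs, h'⟩ := h.step (hd := m + 1) (t := []) (by simp)
      apply Reach.of_step
      rw [hs]
      have := hD.length_eq
      rcases D with _ | ⟨d, D⟩
      · simp at this; omega
      · exact reach_A (A := D ++ [m + 1]) h' (by simp at *; omega) (by simp)
    · obtain ⟨D, hD, hs, h'⟩ := h.step (hd := a) (t := q ++ [m + 1]) (by simp)
      apply Reach.of_step
      rw [hs]
      have := hD.length_eq
      rcases D with _ | ⟨d, D⟩
      · simp at this; omega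
      · exact reach_q q d (D ++ [a]) [] h' (by simp at *; omega)
  · exact reach_A h hA' hm
  · obtain ⟨q1, q2, rfl⟩ := List.append_of_mem hm
    exact reach_q q1 c A q2 h hA'

lemma reach_all {n : ℕ} {π : List ℕ} (h0 : St n 0 π []) :
    ∀ m, 2 * m + 1 ≤ n → Reach n m π := by
  intro m
  induction m with
  | zero => intro _; exact ⟨0, π, [], by simp [build], h0⟩
  | succ m ih =>
    intro hm
    obtain ⟨k, A, q, e, h⟩ := ih (by omega)
    have := h.len
    obtain ⟨k', A', q', e', h'⟩ := reach_succ h (by omega)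
    rw [← e, ← Function.iterate_add_apply] at e'
    exact ⟨_, A', q', e', h'⟩

lemma St.next {n m : ℕ} {A q : List ℕ} (h : St n m A q) :
    ∃ A' q', s132 (A ++ build q) = A' ++ build q' ∧ St n m A' q' := by
  rcases A with _ | ⟨c, A⟩
  · exact absurd rfl h.2.1
  · rcases q with _ | ⟨a, q⟩
    · obtain ⟨D, hD, hs, h'⟩ := h.step (hd := c) (t := []) (by simp)
      exact ⟨_, _, hs, h'⟩
    · obtain ⟨D, hD, hs, h'⟩ := h.step (hd := a) (t := q ++ [c]) (by simp)
      exact ⟨_, _, hs, h'⟩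

lemma St.iter {n m : ℕ} (k : ℕ) : ∀ {A q : List ℕ}, St n m A q →
    ∃ A' q', s132^[k] (A ++ build q) = A' ++ build q' ∧ St n m A' q' := by
  induction k with
  | zero => intro A q h; exact ⟨A, q, rfl, h⟩
  | succ k ih =>
    intro A q h
    obtain ⟨A', q', e, h'⟩ := h.next
    rw [Function.iterate_succ_apply, e]
    exact ih h'

lemma rot_step {n m : ℕ} {A q : List ℕ} (h : St n m A q) (hA : A.length ≤ 2) :
    ∃ A' q', s132 (A ++ build q) = A' ++ build q' ∧ St n m A' q' ∧
      A' ++ q' = (A ++ q).rotate 1 ∧ A'.length = A.length := by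
  rcases A with _ | ⟨c, A⟩
  · exact absurd rfl h.2.1
  obtain ⟨hd, t, e⟩ : ∃ hd t, q ++ [c] = hd :: t := by
    rcases q with _ | ⟨a, q⟩
    · exact ⟨_, _, rfl⟩
    · exact ⟨_, _, rfl⟩
  obtain ⟨D, hD, hs, h'⟩ := h.step e
  have hDA : D = A := by
    rcases A with _ | ⟨d, _ | ⟨d', A⟩⟩
    · simpa using hD
    · simpa using hD
    · simp at hA
  subst hDA
  refine ⟨_, _, hs, h', ?_, by simp⟩
  simp [← e]

lemma rot_iter {n m : ℕ} (k : ℕ) : ∀ {A q : List ℕ}, St n m A q → A.length ≤ 2 →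
    ∃ A' q', s132^[k] (A ++ build q) = A' ++ build q' ∧
      A' ++ q' = (A ++ q).rotate k ∧ A'.length = A.length := by
  induction k with
  | zero => intro A q h _; exact ⟨A, q, rfl, by simp, rfl⟩
  | succ k ih =>
    intro A q h hA
    obtain ⟨A', q', e, h', hr, hl⟩ := rot_step h hA
    obtain ⟨A2, q2, e2, hr2, hl2⟩ := ih h' (by omega)
    refine ⟨A2, q2, ?_, ?_, by omega⟩
    · rw [Function.iterate_succ_apply, e, e2]
    · rw [hr2, hr, List.rotate_rotate, Nat.add_comm]

lemma ent_build : ∀ (q A : List ℕ) (k : ℕ), 1 ≤ k → k ≤ q.length →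
    (A ++ build q).getD (A.length + 2 * q.length - 2 * k) 0 = k := by
  intro q
  induction q with
  | nil => intro A k h1 h2; simp at h2; omega
  | cons a q ih =>
    intro A k h1 h2
    simp only [List.length_cons] at h2 ⊢
    by_cases hk : k = q.length + 1
    · subst hk
      simp [build]
    · have := ih (A ++ [q.length + 1, a]) k h1 (by omega)
      simp only [List.length_append, List.length_cons, List.length_nil] at this
      rw [show A.length + 2 * (q.length + 1) - 2 * k
        = A.length + (0 + 1 + 1) + 2 * q.length - 2 * k by omega]
      simpa [build] using this

lemma length_build (q : List ℕ) : (build q).length = 2 * q.length := by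
  induction q with
  | nil => rfl
  | cons a q ih => simp [build, ih]; omega

lemma build_perm (q : List ℕ) : (build q).Perm (q ++ List.range' 1 q.length) := by
  induction q with
  | nil => simp [build]
  | cons a q ih =>
    simp only [build, List.length_cons, List.range'_1_concat, List.cons_append]
    refine (List.Perm.swap _ _ _).trans (List.Perm.cons a ?_)
    rw [← List.append_assoc, Nat.add_comm 1]
    exact (ih.cons _).trans (List.perm_append_singleton _ _).symm

lemma exists_build (L : List ℕ) : ∀ m, 2 * m ≤ L.length →
    (∀ k, 1 ≤ k → k ≤ m → L.getD (L.length - 2 * k) 0 = k) →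
    ∃ A q, L = A ++ build q ∧ q.length = m := by
  intro m
  induction m with
  | zero => intro _ _; exact ⟨L, [], by simp [build], rfl⟩
  | succ m ih =>
    intro hm hk
    obtain ⟨A, q, e, hq⟩ := ih (by omega) (fun k h1 h2 => hk k h1 (by omega))
    have hlen := congrArg List.length e
    rw [List.length_append, length_build, hq] at hlen
    obtain ⟨A1, a, rfl⟩ : ∃ A1 a, A = A1 ++ [a] := by
      rcases List.eq_nil_or_concat A with rfl | ⟨A1, a, h⟩
      · simp at hlen; omega
      · exact ⟨A1, a, by simpa using h⟩
    obtain ⟨A2, y, rfl⟩ : ∃ A2 y, A1 = A2 ++ [y] := by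
      rcases List.eq_nil_or_concat A1 with rfl | ⟨A1, a, h⟩
      · simp at hlen; omega
      · exact ⟨A1, a, by simpa using h⟩
    have h1 := hk (m + 1) (by omega) le_rfl
    simp at hlen
    rw [show L.length - 2 * (m + 1) = A2.length by omega, e] at h1
    simp at h1
    refine ⟨A2, a :: q, ?_, by simp [hq]⟩
    rw [e, build, hq, h1]
    simp

lemma hd_of_st {n : ℕ} {A q : List ℕ} (h : St n ((n - 1) / 2) A q) :
    HalfDecreasing (A ++ build q) := by
  have hl := h.len
  have h1 := h.1
  have hlen : (A ++ build q).length = n := by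
    rw [List.length_append, length_build]; omega
  intro k hk1 hk2
  rw [hlen] at hk2 ⊢
  rw [ent, show n + 1 - 2 * k - 1 = A.length + 2 * q.length - 2 * k by omega]
  exact ent_build q A k hk1 (by omega)

lemma st_of_hd {n : ℕ} {π : List ℕ} (hn : 1 ≤ n) (hp : π.Perm (List.range' 1 n))
    (h : HalfDecreasing π) : ∃ A q, π = A ++ build q ∧ St n ((n - 1) / 2) A q := by
  have hlen : π.length = n := by simpa using hp.length_eq
  obtain ⟨A, q, e, hq⟩ := exists_build π ((n - 1) / 2) (by omega) (by
    intro k h1 h2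
    have := h k h1 (by rw [hlen]; exact h2)
    rw [ent] at this
    rw [show π.length - 2 * k = π.length + 1 - 2 * k - 1 by omega]
    exact this)
  refine ⟨A, q, e, hq, ?_, ?_⟩
  · rintro rfl
    have := congrArg List.length e
    rw [List.nil_append, length_build] at this
    omega
  · have h1 : ((A ++ q) ++ List.range' 1 ((n - 1) / 2)).Perm (List.range' 1 n) := by
      refine List.Perm.trans ?_ hp
      rw [e, List.append_assoc, ← hq]
      exact (build_perm q).symm.append_left A
    have h2 : List.range' 1 n = List.range' 1 ((n - 1) / 2)
        ++ List.range' ((n - 1) / 2 + 1) (n - (n - 1) / 2) := by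
      have := List.range'_append (s := 1) (m := (n - 1) / 2) (n := n - (n - 1) / 2) (step := 1)
      rw [show (n - 1) / 2 + (n - (n - 1) / 2) = n by omega] at this
      rw [← this]
      congr 2
      omega
    rw [h2] at h1
    exact (List.perm_append_right_iff _).1 (h1.trans List.perm_append_comm)

/-- Berlow: `π ∈ Sₙ` is periodic under `s_{123,132}` iff
`π` is half-decreasing. -/
theorem stmt10 (n : ℕ) (π : List ℕ) (hπ : IsPermOf n π) :
    PeriodicS π ↔ HalfDecreasing π := by
  have hp : π.Perm (List.range' 1 n) := by
    have : List.range' 1 n = (List.range n).map (· + 1) := by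
      rw [List.range'_eq_map_range]
      simp [Nat.add_comm]
    rw [this]
    exact hπ
  rcases Nat.eq_zero_or_pos n with rfl | hn
  · obtain rfl : π = [] := by simpa using hp
    constructor
    · intro _ k h1 h2
      simp at h2
      omega
    · intro _
      exact ⟨1, le_rfl, by simpa [s132, sortT] using run_nil_s10 [] []⟩
  constructor
  · rintro ⟨k, hk, hper⟩
    have h0 : St n 0 π [] := ⟨rfl, by
      rintro rfl
      have := hp.length_eq
      simp at this
      omega, by simpa using hp⟩
    obtain ⟨j, A, q, e, h⟩ := reach_all h0 ((n - 1) / 2) (by omega)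
    obtain ⟨A', q', e', h'⟩ := h.iter (k * j - j)
    rw [← e, ← Function.iterate_add_apply] at e'
    have hkj : k * j - j + j = k * j := Nat.sub_add_cancel (Nat.le_mul_of_pos_left j hk)
    rw [hkj, Function.iterate_mul, Function.iterate_fixed hper] at e'
    rw [e']
    exact hd_of_st h'
  · intro h
    obtain ⟨A, q, e, hst⟩ := st_of_hd hn hp h
    have hl := hst.len
    have hApos := List.length_pos_of_ne_nil hst.2.1
    obtain ⟨A', q', e', hr, hl'⟩ := rot_iter (A ++ q).length hst (by omega)
    rw [List.rotate_length] at hr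
    obtain ⟨rfl, rfl⟩ := List.append_inj hr hl'
    refine ⟨(A' ++ q').length, by simp; omega, ?_⟩
    rw [e]
    exact e'
end
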